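/- arXiv:1605.01267 — 2 statements merged into one kernel-verified Lean document; each statement's English description precedes it below -/
import Mathlib

section
/- For all vectors x, y, z, w in ℝ⁷ one has ψ₀(x,y,z,w)² + ‖τ(x,y,z,w)‖² = |x∧y∧z∧w|² (Harvey–Lawson's identity for the coassociative calibration). -/
noncomputable section
open scoped RealInnerProductSpace

abbrev E7 := EuclideanSpace ℝ (Fin 7)

/-- `dxⁱ ∧ dxʲ ∧ dxᵏ` evaluated on `(x, y, z)` (indices 0-based). -/
def d3 (i j k : Fin 7) (x y z : E7) : ℝ :=
  Matrix.det !![x i, x j, x k; y i, y j, y k; z i, z j, z k]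

/-- `dxⁱ ∧ dxʲ ∧ dxᵏ ∧ dxˡ` evaluated on `(x, y, z, w)` (indices 0-based). -/
def d4 (i j k l : Fin 7) (x y z w : E7) : ℝ :=
  Matrix.det !![x i, x j, x k, x l; y i, y j, y k, y l;
                z i, z j, z k, z l; w i, w j, w k, w l]

/-- The associative 3-form
`φ₀ = dx¹²³ + dx¹⁴⁵ − dx¹⁶⁷ + dx²⁴⁶ + dx²⁵⁷ + dx³⁴⁷ − dx³⁵⁶` (1-based indices; here 0-based). -/
def phi (x y z : E7) : ℝ :=
  d3 0 1 2 x y z + d3 0 3 4 x y z - d3 0 5 6 x y z + d3 1 3 5 x y z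
    + d3 1 4 6 x y z + d3 2 3 6 x y z - d3 2 4 5 x y z

/-- The coassociative 4-form
`ψ₀ = dx⁴⁵⁶⁷ + dx²³⁶⁷ − dx²³⁴⁵ + dx¹³⁵⁷ + dx¹³⁴⁶ + dx¹²⁵⁶ − dx¹²⁴⁷` (1-based; here 0-based). -/
def psi (x y z w : E7) : ℝ :=
  d4 3 4 5 6 x y z w + d4 1 2 5 6 x y z w - d4 1 2 3 4 x y z w + d4 0 2 4 6 x y z w
    + d4 0 2 3 5 x y z w + d4 0 1 4 5 x y z w - d4 0 1 3 6 x y z w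

/-- The vector-valued 4-form
`τ(x,y,z,w) = −(φ₀(y,z,w)x + φ₀(z,x,w)y + φ₀(x,y,w)z + φ₀(y,x,z)w)`. -/
def tau (x y z w : E7) : E7 :=
  -(phi y z w • x + phi z x w • y + phi x y w • z + phi y x z • w)

/-- The Gram determinant `|x∧y∧z∧w|² = det(⟨vᵢ,vⱼ⟩)`. -/
def gram4 (x y z w : E7) : ℝ :=
  Matrix.det !![⟪x, x⟫, ⟪x, y⟫, ⟪x, z⟫, ⟪x, w⟫;
                ⟪y, x⟫, ⟪y, y⟫, ⟪y, z⟫, ⟪y, w⟫;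
                ⟪z, x⟫, ⟪z, y⟫, ⟪z, z⟫, ⟪z, w⟫;
                ⟪w, x⟫, ⟪w, y⟫, ⟪w, z⟫, ⟪w, w⟫]


theorem d3_eq (i j k : Fin 7) (x y z : E7) : d3 i j k x y z =
    x i * (y j * z k - y k * z j) - x j * (y i * z k - y k * z i)
      + x k * (y i * z j - y j * z i) := by
  simp [d3, Matrix.det_fin_three]
  ring

theorem d4_eq (i j k l : Fin 7) (x y z w : E7) : d4 i j k l x y z w =
    (x i * y j - x j * y i) * (z k * w l - z l * w k)
    - (x i * y k - x k * y i) * (z j * w l - z l * w j)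
    + (x i * y l - x l * y i) * (z j * w k - z k * w j)
    + (x j * y k - x k * y j) * (z i * w l - z l * w i)
    - (x j * y l - x l * y j) * (z i * w k - z k * w i)
    + (x k * y l - x l * y k) * (z i * w j - z j * w i) := by
  simp [d4, Matrix.det_succ_row_zero, Fin.sum_univ_succ, Fin.succAbove]
  ring

theorem d4_swap12 {i j : Fin 7} (k l : Fin 7) (_ : j < i) (x y z w : E7) :
    d4 i j k l x y z w = - d4 j i k l x y z w := by
  simp only [d4_eq]; ring

theorem d4_swap23 {j k : Fin 7} (i l : Fin 7) (_ : k < j) (x y z w : E7) :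
    d4 i j k l x y z w = - d4 i k j l x y z w := by
  simp only [d4_eq]; ring

theorem d4_swap34 {k l : Fin 7} (i j : Fin 7) (_ : l < k) (x y z w : E7) :
    d4 i j k l x y z w = - d4 i j l k x y z w := by
  simp only [d4_eq]; ring

set_option maxHeartbeats 4000000 in
/-- Three-term Plücker relation. -/
theorem plucker (i j a b c d : Fin 7) (x y z w : E7) :
    d4 i j a b x y z w * d4 i j c d x y z w - d4 i j a c x y z w * d4 i j b d x y z w
      + d4 i j a d x y z w * d4 i j b c x y z w = 0 := by
  simp only [d4_eq]; ring

theorem tau_0 (x y z w : E7) : tau x y z w 0 =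
    -d4 0 1 3 5 x y z w - d4 0 1 4 6 x y z w - d4 0 2 3 6 x y z w + d4 0 2 4 5 x y z w := by
  simp only [tau, phi, d3_eq, d4_eq, PiLp.neg_apply, PiLp.add_apply, PiLp.smul_apply, smul_eq_mul]
  ring

theorem tau_1 (x y z w : E7) : tau x y z w 1 =
    d4 0 1 3 4 x y z w - d4 0 1 5 6 x y z w - d4 1 2 3 6 x y z w + d4 1 2 4 5 x y z w := by
  simp only [tau, phi, d3_eq, d4_eq, PiLp.neg_apply, PiLp.add_apply, PiLp.smul_apply, smul_eq_mul]
  ring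

theorem tau_2 (x y z w : E7) : tau x y z w 2 =
    d4 0 2 3 4 x y z w - d4 0 2 5 6 x y z w + d4 1 2 3 5 x y z w + d4 1 2 4 6 x y z w := by
  simp only [tau, phi, d3_eq, d4_eq, PiLp.neg_apply, PiLp.add_apply, PiLp.smul_apply, smul_eq_mul]
  ring

theorem tau_3 (x y z w : E7) : tau x y z w 3 =
    d4 0 1 2 3 x y z w - d4 0 3 5 6 x y z w + d4 1 3 4 6 x y z w - d4 2 3 4 5 x y z w := by
  simp only [tau, phi, d3_eq, d4_eq, PiLp.neg_apply, PiLp.add_apply, PiLp.smul_apply, smul_eq_mul]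
  ring

theorem tau_4 (x y z w : E7) : tau x y z w 4 =
    d4 0 1 2 4 x y z w - d4 0 4 5 6 x y z w - d4 1 3 4 5 x y z w - d4 2 3 4 6 x y z w := by
  simp only [tau, phi, d3_eq, d4_eq, PiLp.neg_apply, PiLp.add_apply, PiLp.smul_apply, smul_eq_mul]
  ring

theorem tau_5 (x y z w : E7) : tau x y z w 5 =
    d4 0 1 2 5 x y z w + d4 0 3 4 5 x y z w - d4 1 4 5 6 x y z w - d4 2 3 5 6 x y z w := by
  simp only [tau, phi, d3_eq, d4_eq, PiLp.neg_apply, PiLp.add_apply, PiLp.smul_apply, smul_eq_mul]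
  ring

theorem tau_6 (x y z w : E7) : tau x y z w 6 =
    d4 0 1 2 6 x y z w + d4 0 3 4 6 x y z w + d4 1 3 5 6 x y z w - d4 2 4 5 6 x y z w := by
  simp only [tau, phi, d3_eq, d4_eq, PiLp.neg_apply, PiLp.add_apply, PiLp.smul_apply, smul_eq_mul]
  ring

/-- `24 · det (A Aᵀ)` as the sum of the squares of all (ordered) maximal minors. -/
theorem binet_aux (A : Matrix (Fin 4) (Fin 7) ℝ) :
    24 * (A * A.transpose).det
      = ∑ f : Fin 4 → Fin 7, (A.submatrix id f).det ^ 2 := by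
  have h1 : (A * A.transpose).det
      = ∑ f : Fin 4 → Fin 7, (∏ i, A i (f i)) * (A.submatrix id f).det := by
    have e : (A * A.transpose) = fun i => ∑ k, A i k • (fun j => A j k) := by
      ext i j
      simp [Matrix.mul_apply, Finset.sum_apply]
    rw [e]
    change (Matrix.detRowAlternating (n := Fin 4) (R := ℝ)).toMultilinearMap _ = _
    rw [MultilinearMap.map_sum]
    refine Finset.sum_congr rfl fun f _ => ?_
    rw [MultilinearMap.map_smul_univ, smul_eq_mul]
    congr 1
    rw [← Matrix.det_transpose]
    rfl
  have h2 : ∀ σ : Equiv.Perm (Fin 4), (A * A.transpose).det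
      = ∑ f : Fin 4 → Fin 7,
        ((Equiv.Perm.sign σ : ℤ) : ℝ) * (∏ i, A i (f (σ i))) * (A.submatrix id f).det := by
    intro σ
    rw [h1, ← Equiv.sum_comp (Equiv.arrowCongr σ.symm (Equiv.refl (Fin 7)))]
    refine Finset.sum_congr rfl fun f _ => ?_
    have : (A.submatrix id ((Equiv.arrowCongr σ.symm (Equiv.refl (Fin 7))) f)).det
        = ((Equiv.Perm.sign σ : ℤ) : ℝ) * (A.submatrix id f).det := by
      rw [← Matrix.det_permute']
      rfl
    rw [this]
    simp only [Equiv.arrowCongr_apply, Equiv.coe_refl, Function.comp_apply, id, Equiv.symm_symm]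
    ring
  have h3 : ∑ σ : Equiv.Perm (Fin 4), (A * A.transpose).det = 24 * (A * A.transpose).det := by
    rw [Finset.sum_const, Finset.card_univ, Fintype.card_perm, Fintype.card_fin]
    norm_num [Nat.factorial]
  rw [← h3, Finset.sum_congr rfl fun σ _ => h2 σ, Finset.sum_comm]
  refine Finset.sum_congr rfl fun f _ => ?_
  rw [← Finset.sum_mul, sq]
  congr 1
  rw [← Matrix.det_transpose, Matrix.det_apply']
  rfl

theorem sum_fun4 {n : ℕ} (F : (Fin 4 → Fin n) → ℝ) :
    ∑ f, F f = ∑ i, ∑ j, ∑ k, ∑ l, F ![i, j, k, l] := by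
  rw [← (Fin.consEquiv fun _ => Fin n).sum_comp, Fintype.sum_prod_type]
  refine Finset.sum_congr rfl fun i _ => ?_
  rw [← (Fin.consEquiv fun _ => Fin n).sum_comp, Fintype.sum_prod_type]
  refine Finset.sum_congr rfl fun j _ => ?_
  rw [← (Fin.consEquiv fun _ => Fin n).sum_comp, Fintype.sum_prod_type]
  refine Finset.sum_congr rfl fun k _ => ?_
  rw [← (Fin.consEquiv fun _ => Fin n).sum_comp, Fintype.sum_prod_type]
  refine Finset.sum_congr rfl fun l _ => ?_
  rw [Fintype.sum_unique]
  congr 1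

theorem sym2 {n : ℕ} (F : Fin (n + 1) → Fin (n + 1) → ℝ) (h0 : ∀ i, F i i = 0)
    (h1 : ∀ i j, F i j = F j i) :
    ∑ i, ∑ j, F i j = 2 * ∑ j : Fin n, F 0 j.succ + ∑ i : Fin n, ∑ j : Fin n, F i.succ j.succ := by
  simp only [Fin.sum_univ_succ (n := n), Finset.sum_add_distrib, h0, fun i : Fin n => h1 i.succ 0]
  ring

theorem sym3 {n : ℕ} (F : Fin (n + 1) → Fin (n + 1) → Fin (n + 1) → ℝ) (h0 : ∀ i k, F i i k = 0)
    (h1 : ∀ i j k, F i j k = F j i k) (h2 : ∀ i j k, F i j k = F i k j) :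
    ∑ i, ∑ j, ∑ k, F i j k = 3 * ∑ j : Fin n, ∑ k : Fin n, F 0 j.succ k.succ
      + ∑ i : Fin n, ∑ j : Fin n, ∑ k : Fin n, F i.succ j.succ k.succ := by
  have e1 : ∀ k, F k 0 0 = 0 := fun k => by rw [h1, h2, h0]
  simp only [Fin.sum_univ_succ (n := n), Finset.sum_add_distrib, h0, e1,
    fun k : Fin n => h2 0 k.succ 0, fun (i k : Fin n) => h1 i.succ 0 k.succ,
    fun (i k : Fin n) => h2 i.succ k.succ 0, Finset.sum_const_zero]
  ring

theorem sym4 {n : ℕ} (F : Fin (n + 1) → Fin (n + 1) → Fin (n + 1) → Fin (n + 1) → ℝ)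
    (h0 : ∀ i k l, F i i k l = 0) (h1 : ∀ i j k l, F i j k l = F j i k l)
    (h2 : ∀ i j k l, F i j k l = F i k j l) (h3 : ∀ i j k l, F i j k l = F i j l k) :
    ∑ i, ∑ j, ∑ k, ∑ l, F i j k l
      = 4 * ∑ j : Fin n, ∑ k : Fin n, ∑ l : Fin n, F 0 j.succ k.succ l.succ
      + ∑ i : Fin n, ∑ j : Fin n, ∑ k : Fin n, ∑ l : Fin n, F i.succ j.succ k.succ l.succ := by
  have e1 : ∀ k l, F k 0 0 l = 0 := fun k l => by rw [h1, h2, h0]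
  have e2 : ∀ k l, F k l 0 0 = 0 := fun k l => by rw [h2, h3, e1]
  have e3 : ∀ k l, F k 0 l 0 = 0 := fun k l => by rw [h3, e1]
  simp only [Fin.sum_univ_succ (n := n), Finset.sum_add_distrib, h0, e1, e2, e3,
    fun k l : Fin n => h2 0 k.succ 0 l.succ, fun k l : Fin n => h3 0 k.succ l.succ 0,
    fun (i k l : Fin n) => h1 i.succ 0 k.succ l.succ,
    fun (i k l : Fin n) => h2 i.succ k.succ 0 l.succ,
    fun (i k l : Fin n) => h3 i.succ k.succ l.succ 0, Finset.sum_const_zero]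
  ring


theorem gram4_eq (x y z w : E7) : 24 * gram4 x y z w
    = ∑ i, ∑ j, ∑ k, ∑ l, d4 i j k l x y z w ^ 2 := by
  have hA : gram4 x y z w = ((Matrix.of ![x.ofLp, y.ofLp, z.ofLp, w.ofLp])
      * (Matrix.of ![x.ofLp, y.ofLp, z.ofLp, w.ofLp]).transpose).det := by
    unfold gram4
    congr 1
    ext i j
    fin_cases i <;> fin_cases j <;>
      simp [Matrix.mul_apply, PiLp.inner_apply, mul_comm,
        -inner_self_eq_norm_sq_to_K]
  rw [hA, binet_aux, sum_fun4]
  refine Finset.sum_congr rfl fun i _ => Finset.sum_congr rfl fun j _ =>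
    Finset.sum_congr rfl fun k _ => Finset.sum_congr rfl fun l _ => ?_
  unfold d4
  congr 2
  ext a b
  fin_cases a <;> fin_cases b <;> rfl

/-- Sum over strictly increasing pairs. -/
def S2 : (n : ℕ) → (Fin n → Fin n → ℝ) → ℝ
  | 0, _ => 0
  | n + 1, F => (∑ j : Fin n, F 0 j.succ) + S2 n fun i j => F i.succ j.succ

/-- Sum over strictly increasing triples. -/
def S3 : (n : ℕ) → (Fin n → Fin n → Fin n → ℝ) → ℝ
  | 0, _ => 0
  | n + 1, F => (S2 n fun j k => F 0 j.succ k.succ) + S3 n fun i j k => F i.succ j.succ k.succ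

/-- Sum over strictly increasing quadruples. -/
def S4 : (n : ℕ) → (Fin n → Fin n → Fin n → Fin n → ℝ) → ℝ
  | 0, _ => 0
  | n + 1, F => (S3 n fun j k l => F 0 j.succ k.succ l.succ)
      + S4 n fun i j k l => F i.succ j.succ k.succ l.succ

theorem sum_S2 : ∀ (n : ℕ) (F : Fin n → Fin n → ℝ) (_ : ∀ i, F i i = 0)
    (_ : ∀ i j, F i j = F j i), ∑ i, ∑ j, F i j = 2 * S2 n F
  | 0, F, _, _ => by simp [S2]
  | n + 1, F, h0, h1 => by
    rw [sym2 F h0 h1, S2, sum_S2 n (fun i j => F i.succ j.succ) (fun _ => h0 _) (fun _ _ => h1 _ _)]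
    ring

theorem sum_S3 : ∀ (n : ℕ) (F : Fin n → Fin n → Fin n → ℝ) (_ : ∀ i k, F i i k = 0)
    (_ : ∀ i j k, F i j k = F j i k) (_ : ∀ i j k, F i j k = F i k j),
    ∑ i, ∑ j, ∑ k, F i j k = 6 * S3 n F
  | 0, F, _, _, _ => by simp [S3]
  | n + 1, F, h0, h1, h2 => by
    rw [sym3 F h0 h1 h2, S3, sum_S3 n (fun i j k => F i.succ j.succ k.succ) (fun _ _ => h0 _ _)
      (fun _ _ _ => h1 _ _ _) (fun _ _ _ => h2 _ _ _),
      sum_S2 n (fun j k => F 0 j.succ k.succ) (fun _ => by rw [h1, h2, h0]) (fun _ _ => h2 _ _ _)]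
    ring

theorem sum_S4 : ∀ (n : ℕ) (F : Fin n → Fin n → Fin n → Fin n → ℝ) (_ : ∀ i k l, F i i k l = 0)
    (_ : ∀ i j k l, F i j k l = F j i k l) (_ : ∀ i j k l, F i j k l = F i k j l)
    (_ : ∀ i j k l, F i j k l = F i j l k),
    ∑ i, ∑ j, ∑ k, ∑ l, F i j k l = 24 * S4 n F
  | 0, F, _, _, _, _ => by simp [S4]
  | n + 1, F, h0, h1, h2, h3 => by
    rw [sym4 F h0 h1 h2 h3, S4, sum_S4 n (fun i j k l => F i.succ j.succ k.succ l.succ)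
      (fun _ _ _ => h0 _ _ _) (fun _ _ _ _ => h1 _ _ _ _) (fun _ _ _ _ => h2 _ _ _ _)
      (fun _ _ _ _ => h3 _ _ _ _),
      sum_S3 n (fun j k l => F 0 j.succ k.succ l.succ) (fun _ _ => by rw [h1, h2, h0])
      (fun _ _ _ => h2 _ _ _ _) (fun _ _ _ => h3 _ _ _ _)]
    ring

theorem gram4_sum (x y z w : E7) : gram4 x y z w =
      d4 0 1 2 3 x y z w ^ 2 + d4 0 1 2 4 x y z w ^ 2 + d4 0 1 2 5 x y z w ^ 2 + d4 0 1 2 6 x y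
      z w ^ 2 + d4 0 1 3 4 x y z w ^ 2 + d4 0 1 3 5 x y z w ^ 2 + d4 0 1 3 6 x y z w ^ 2 + d4 0
      1 4 5 x y z w ^ 2 + d4 0 1 4 6 x y z w ^ 2 + d4 0 1 5 6 x y z w ^ 2 + d4 0 2 3 4 x y z w ^
      2 + d4 0 2 3 5 x y z w ^ 2 + d4 0 2 3 6 x y z w ^ 2 + d4 0 2 4 5 x y z w ^ 2 + d4 0 2 4 6
      x y z w ^ 2 + d4 0 2 5 6 x y z w ^ 2 + d4 0 3 4 5 x y z w ^ 2 + d4 0 3 4 6 x y z w ^ 2 +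
      d4 0 3 5 6 x y z w ^ 2 + d4 0 4 5 6 x y z w ^ 2 + d4 1 2 3 4 x y z w ^ 2 + d4 1 2 3 5 x y
      z w ^ 2 + d4 1 2 3 6 x y z w ^ 2 + d4 1 2 4 5 x y z w ^ 2 + d4 1 2 4 6 x y z w ^ 2 + d4 1
      2 5 6 x y z w ^ 2 + d4 1 3 4 5 x y z w ^ 2 + d4 1 3 4 6 x y z w ^ 2 + d4 1 3 5 6 x y z w ^
      2 + d4 1 4 5 6 x y z w ^ 2 + d4 2 3 4 5 x y z w ^ 2 + d4 2 3 4 6 x y z w ^ 2 + d4 2 3 5 6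
      x y z w ^ 2 + d4 2 4 5 6 x y z w ^ 2 + d4 3 4 5 6 x y z w ^ 2 := by
  have h := gram4_eq x y z w
  rw [sum_S4 7 (fun i j k l => d4 i j k l x y z w ^ 2)] at h
  · have hh := mul_left_cancel₀ (by norm_num) h
    rw [hh]
    simp only [S4, S3, S2, Fin.sum_univ_succ, Fin.sum_univ_zero]
    simp only [Fin.succ_zero_eq_one, Fin.reduceSucc]
    ring
  all_goals intros; simp only [d4_eq]; ring

/-- Harvey–Lawson's identity for the coassociative calibration:
`ψ₀(x,y,z,w)² + ‖τ(x,y,z,w)‖² = |x∧y∧z∧w|²` for all `x, y, z, w ∈ ℝ⁷`. -/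
theorem coassociative_harvey_lawson :
    ∀ x y z w : E7, psi x y z w ^ 2 + ‖tau x y z w‖ ^ 2 = gram4 x y z w := by
  intro x y z w
  rw [gram4_sum, EuclideanSpace.norm_sq_eq, Fin.sum_univ_seven]
  simp only [Real.norm_eq_abs, sq_abs, tau_0, tau_1, tau_2, tau_3, tau_4, tau_5, tau_6, psi]
  have h0 := plucker 0 1 3 4 5 6 x y z w
  have h1 := plucker 0 2 3 4 5 6 x y z w
  have h2 := plucker 0 3 1 2 5 6 x y z w
  have h3 := plucker 0 4 1 2 5 6 x y z w
  have h4 := plucker 0 5 1 2 3 4 x y z w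
  have h5 := plucker 0 6 1 2 3 4 x y z w
  have h6 := plucker 1 2 3 4 5 6 x y z w
  have h7 := plucker 1 3 0 2 4 6 x y z w
  have h8 := plucker 1 4 0 2 3 5 x y z w
  have h9 := plucker 1 5 0 2 4 6 x y z w
  have h10 := plucker 1 6 0 2 3 5 x y z w
  have h11 := plucker 2 3 0 1 4 5 x y z w
  have h12 := plucker 2 4 0 1 3 6 x y z w
  have h13 := plucker 2 5 0 1 3 6 x y z w
  have h14 := plucker 2 6 0 1 4 5 x y z w
  have h15 := plucker 3 4 1 2 5 6 x y z w
  have h16 := plucker 3 5 0 2 4 6 x y z w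
  have h17 := plucker 3 6 0 1 4 5 x y z w
  have h18 := plucker 4 5 0 1 3 6 x y z w
  have h19 := plucker 4 6 0 2 3 5 x y z w
  have h20 := plucker 5 6 1 2 3 4 x y z w
  simp (discharger := decide) only [d4_swap12, d4_swap23, d4_swap34] at h0 h1 h2 h3 h4 h5 h6 h7 h8 h9 h10 h11 h12 h13 h14 h15 h16 h17 h18 h19 h20
  linear_combination - 2 * h0 - 2 * h1 - 2 * h2 - 2 * h3 + 2 * h4 + 2 * h5 - 2 * h6 - 2 * h7 - 2 * h8 - 2 * h9 - 2 * h10 - 2 * h11 + 2 * h12 + 2 * h13 - 2 * h14 - 2 * h15 - 2 * h16 - 2 * h17 + 2 * h18 - 2 * h19 + 2 * h20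
end
end

section
/- Let ξ be a 3-dimensional subspace of ℝ⁷ admitting an orthonormal basis e₁, e₂, e₃ with φ₀(e₁,e₂,e₃) = 1 (an associative 3-plane). Then for every u ∈ ξ and every v orthogonal to ξ, the cross product u × v is orthogonal to ξ (cross product by tangent vectors preserves the normal space of an associative plane). -/
noncomputable section
open scoped RealInnerProductSpace

theorem phi_expand (x y z : E7) : phi x y z =
    (x 0*(y 1*z 2 - y 2*z 1) - x 1*(y 0*z 2 - y 2*z 0) + x 2*(y 0*z 1 - y 1*z 0))
  + (x 0*(y 3*z 4 - y 4*z 3) - x 3*(y 0*z 4 - y 4*z 0) + x 4*(y 0*z 3 - y 3*z 0))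
  - (x 0*(y 5*z 6 - y 6*z 5) - x 5*(y 0*z 6 - y 6*z 0) + x 6*(y 0*z 5 - y 5*z 0))
  + (x 1*(y 3*z 5 - y 5*z 3) - x 3*(y 1*z 5 - y 5*z 1) + x 5*(y 1*z 3 - y 3*z 1))
  + (x 1*(y 4*z 6 - y 6*z 4) - x 4*(y 1*z 6 - y 6*z 1) + x 6*(y 1*z 4 - y 4*z 1))
  + (x 2*(y 3*z 6 - y 6*z 3) - x 3*(y 2*z 6 - y 6*z 2) + x 6*(y 2*z 3 - y 3*z 2))
  - (x 2*(y 4*z 5 - y 5*z 4) - x 4*(y 2*z 5 - y 5*z 2) + x 5*(y 2*z 4 - y 4*z 2)) := by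
  simp only [phi, d3, Matrix.det_fin_three, Matrix.of_apply, Matrix.cons_val', Matrix.cons_val]
  ring

theorem phi_rot (x y z : E7) : phi x y z = phi y z x := by
  simp only [phi_expand]; ring

theorem phi_swap (x y z : E7) : phi x y z = - phi y x z := by
  simp only [phi_expand]; ring

theorem phi_comb (u v t : E7) (a b : Fin 3 → ℝ) (e : Fin 3 → E7)
    (hu : ∑ i, a i • e i = u) (ht : ∑ i, b i • e i = t) :
    phi u v t = ∑ i, ∑ j, a i * b j * phi (e i) v (e j) := by
  subst hu ht
  simp only [phi_expand, Fin.sum_univ_three, PiLp.add_apply, PiLp.smul_apply, smul_eq_mul]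
  ring

theorem inner_expand (x y : E7) : ⟪x, y⟫ = x 0*y 0 + x 1*y 1 + x 2*y 2 + x 3*y 3
    + x 4*y 4 + x 5*y 5 + x 6*y 6 := by
  simp only [PiLp.inner_apply, Fin.sum_univ_seven, RCLike.inner_apply, conj_trivial]
  ring

/-- Explicit coordinates of the cross product. -/
def crs (x y : E7) : E7 := WithLp.toLp 2 fun i => phi x y (EuclideanSpace.single i 1)

theorem inner_crs (x y z : E7) : ⟪crs x y, z⟫ = phi x y z := by
  rw [inner_expand]
  simp [crs, phi_expand]
  ring

theorem crs_norm (x y : E7) : ⟪crs x y, crs x y⟫ = ⟪x, x⟫ * ⟪y, y⟫ - ⟪x, y⟫ ^ 2 := by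
  simp only [inner_expand]
  simp [crs, phi_expand]
  ring

theorem phi_key (x y z v : E7) (hx : ⟪x, x⟫ = 1) (hy : ⟪y, y⟫ = 1) (hz : ⟪z, z⟫ = 1)
    (hxy : ⟪x, y⟫ = 0) (h : phi x y z = 1) : phi x y v = ⟪z, v⟫ := by
  have h0 : ⟪crs x y - z, crs x y - z⟫ = 0 := by
    rw [inner_sub_left, inner_sub_right, inner_sub_right, real_inner_comm (crs x y) z, crs_norm,
      inner_crs, hx, hy, hz, hxy, h]
    norm_num
  rw [← inner_crs, sub_eq_zero.1 (inner_self_eq_zero.1 h0)]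

/-- on an associative 3-plane ξ, the cross product of a tangent
vector with a normal vector is normal. -/
theorem cross_tangent_normal_is_normal
    (cross : E7 → E7 → E7)
    (hcross : ∀ x y z : E7, ⟪cross x y, z⟫ = phi x y z)
    (ξ : Submodule ℝ E7) (hdim : Module.finrank ℝ ξ = 3)
    (e : Fin 3 → E7) (hmem : ∀ i, e i ∈ ξ) (horth : Orthonormal ℝ e)
    (hcal : phi (e 0) (e 1) (e 2) = 1) :
    ∀ u ∈ ξ, ∀ v : E7, (∀ t ∈ ξ, ⟪v, t⟫ = 0) → ∀ t ∈ ξ, ⟪cross u v, t⟫ = 0 := by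
  intro u hu v hv t ht
  have hspan : Submodule.span ℝ (Set.range e) = ξ := by
    apply Submodule.eq_of_le_of_finrank_eq
    · rw [Submodule.span_le]
      rintro _ ⟨i, rfl⟩
      exact hmem i
    · rw [hdim, finrank_span_eq_card horth.linearIndependent, Fintype.card_fin]
  rw [← hspan] at hu ht
  obtain ⟨a, ha⟩ := (Submodule.mem_span_range_iff_exists_fun ℝ).1 hu
  obtain ⟨b, hb⟩ := (Submodule.mem_span_range_iff_exists_fun ℝ).1 ht
  have h1 : ∀ i, ⟪e i, e i⟫ = 1 := fun i => by
    rw [real_inner_self_eq_norm_sq, horth.1 i]; norm_num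
  have h2 : ∀ i j, i ≠ j → ⟪e i, e j⟫ = 0 := fun i j hij => horth.2 hij
  have hev : ∀ i, ⟪e i, v⟫ = 0 := fun i => by rw [real_inner_comm]; exact hv _ (hmem i)
  have k01 : phi (e 0) (e 1) v = 0 := by
    rw [phi_key _ _ (e 2) v (h1 0) (h1 1) (h1 2) (h2 _ _ (by decide)) hcal, hev]
  have k12 : phi (e 1) (e 2) v = 0 := by
    rw [phi_key _ _ (e 0) v (h1 1) (h1 2) (h1 0) (h2 _ _ (by decide))
      (by rw [← phi_rot]; exact hcal), hev]
  have k20 : phi (e 2) (e 0) v = 0 := by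
    rw [phi_key _ _ (e 1) v (h1 2) (h1 0) (h1 1) (h2 _ _ (by decide))
      (by rw [phi_rot]; exact hcal), hev]
  have kd : ∀ x, phi x v x = 0 := fun x => by simp only [phi_expand]; ring
  have r : ∀ x y, phi x v y = phi y x v := fun x y => (phi_rot y x v).symm
  rw [hcross, phi_comb u v t a b e ha hb]
  simp only [Fin.sum_univ_three, kd]
  rw [r (e 0) (e 1), r (e 0) (e 2), r (e 1) (e 0), r (e 1) (e 2), r (e 2) (e 0), r (e 2) (e 1),
    phi_swap (e 1) (e 0), phi_swap (e 2) (e 1), phi_swap (e 0) (e 2), k01, k12, k20]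
  ring
end
end
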